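/- For all a,b,p,q ∈ {1,…,n−1} and all i,j,k,l ∈ {1,…,w}: u^{ab}_{ij} · u^{pq}_{kl} = d^{δ_{bp}} · φ_{jk}((b n−1)(b p)(p n−1)) · u^{aq}_{il}, where the permutation (b n−1)(b p)(p n−1) fixes both n−1 and n and is regarded as an element of S(n−2). In particular u^{aa}_{ii} · u^{aa}_{ii} = d · u^{aa}_{ii}, i.e. the elements u^{aa}_{ii} are essential projectors. -/

import Mathlib

/-- The permutation operator `V(σ)` on `(ℂ^d)^{⊗ n}`, realized as the square matrix
indexed by functions `f g : Fin n → Fin d`, with entry `1` if `g = f ∘ σ` and `0` otherwise. -/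
noncomputable def V (n d : ℕ) (σ : Equiv.Perm (Fin n)) :
    Matrix (Fin n → Fin d) (Fin n → Fin d) ℂ :=
  Matrix.of fun f g => if g = f ∘ σ then 1 else 0

/-- Partial transpose of a matrix on `(ℂ^d)^{⊗ n}` at position `p`. -/
noncomputable def pt {n d : ℕ} (p : Fin n)
    (A : Matrix (Fin n → Fin d) (Fin n → Fin d) ℂ) :
    Matrix (Fin n → Fin d) (Fin n → Fin d) ℂ :=
  Matrix.of fun f g =>
    A (Function.update f p (g p)) (Function.update g p (f p))

/-- The last position `n` of the tensor product, as an element of `Fin n`. -/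
def lastIdx (n : ℕ) (hn : 1 ≤ n) : Fin n := ⟨n - 1, by omega⟩

/-- The matrix operators `E_{ij} = (w/(n−2)!) Σ_{σ ∈ S(n−2)} φ_{ji}(σ⁻¹) V(σ)`, where the
sum runs over the subgroup of `S(n)` fixing both positions `ln1` (= `n−1`) and `ln` (= `n`). -/
noncomputable def Emat (n d w : ℕ) (ln ln1 : Fin n)
    (φ : Equiv.Perm (Fin n) → Matrix (Fin w) (Fin w) ℂ) (i j : Fin w) :
    Matrix (Fin n → Fin d) (Fin n → Fin d) ℂ :=
  ((w : ℂ) / (Nat.factorial (n - 2) : ℂ)) •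
    ∑ σ ∈ Finset.univ.filter
        (fun σ : Equiv.Perm (Fin n) => σ ln = ln ∧ σ ln1 = ln1),
      (φ σ⁻¹ j i) • V n d σ

/-- The elements `u^{ab}_{ij} = V((a n))^{t_n} · V((a n−1)) · E_{ij} · V((b n−1))`, where
`ln` is position `n`, `ln1` is position `n−1`, and `(x y)` with `x = y` is the identity. -/
noncomputable def umat (n d w : ℕ) (ln ln1 : Fin n)
    (φ : Equiv.Perm (Fin n) → Matrix (Fin w) (Fin w) ℂ)
    (a b : Fin n) (i j : Fin w) :
    Matrix (Fin n → Fin d) (Fin n → Fin d) ℂ :=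
  pt ln (V n d (Equiv.swap a ln)) * V n d (Equiv.swap a ln1) *
    Emat n d w ln ln1 φ i j * V n d (Equiv.swap b ln1)

section PermutationOperators

variable {n d : ℕ}

theorem V_mul_apply (σ : Equiv.Perm (Fin n))
    (M : Matrix (Fin n → Fin d) (Fin n → Fin d) ℂ) (f g : Fin n → Fin d) :
    (V n d σ * M) f g = M (f ∘ σ) g := by
  simp [Matrix.mul_apply, V]

theorem mul_V_apply (σ : Equiv.Perm (Fin n))
    (M : Matrix (Fin n → Fin d) (Fin n → Fin d) ℂ) (f g : Fin n → Fin d) :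
    (M * V n d σ) f g = M f (g ∘ σ.symm) := by
  have h : ∀ x : Fin n → Fin d, g = x ∘ σ ↔ g ∘ σ.symm = x := fun x =>
    (Equiv.comp_symm_eq σ x g).symm
  simp [Matrix.mul_apply, V, h]

theorem V_mul_V (σ τ : Equiv.Perm (Fin n)) : V n d σ * V n d τ = V n d (σ * τ) := by
  ext f g
  rw [V_mul_apply]
  rfl

theorem V_one : V n d 1 = 1 := by
  ext f g
  simp [V, Matrix.one_apply, eq_comm]

theorem pt_V_swap_apply {a ln : Fin n} (ha : a ≠ ln) (f g : Fin n → Fin d) :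
    pt ln (V n d (Equiv.swap a ln)) f g =
      if f a = f ln ∧ g a = g ln ∧ ∀ x, x ≠ a → x ≠ ln → f x = g x then 1 else 0 := by
  simp only [pt, V, Matrix.of_apply]
  congr 1
  rw [funext_iff, eq_iff_iff]
  constructor
  · intro h
    refine ⟨?_, ?_, fun x hxa hxl => ?_⟩
    · have := h ln
      simpa [ha, eq_comm] using this
    · have := h a
      simpa [ha, eq_comm] using this
    · have := h x
      simpa [Equiv.swap_apply_of_ne_of_ne hxa hxl, hxl, eq_comm] using this
  · rintro ⟨h1, h2, h3⟩ x
    by_cases hxl : x = ln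
    · subst hxl
      simp [ha, h1]
    · by_cases hxa : x = a
      · subst hxa
        simp [ha, h2]
      · simp [Equiv.swap_apply_of_ne_of_ne hxa hxl, hxl, h3 x hxa hxl]

theorem V_mul_pt_V_swap {a ln : Fin n} (ha : a ≠ ln) {σ : Equiv.Perm (Fin n)}
    (hσ : σ ln = ln) :
    V n d σ * pt ln (V n d (Equiv.swap a ln)) =
      pt ln (V n d (Equiv.swap (σ a) ln)) * V n d σ := by
  have ha' : σ a ≠ ln := fun h => ha (σ.injective (h.trans hσ.symm))
  have hσ' : σ.symm ln = ln := by rw [Equiv.symm_apply_eq, hσ]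
  ext f g
  rw [V_mul_apply, mul_V_apply, pt_V_swap_apply ha, pt_V_swap_apply ha']
  congr 1
  simp only [Function.comp_apply, hσ, hσ', Equiv.symm_apply_apply, eq_iff_iff]
  refine and_congr_right fun _ => and_congr_right fun _ => ?_
  constructor
  · intro h x hxa hxl
    simpa using h (σ.symm x) (by rwa [Ne, Equiv.symm_apply_eq])
      (by rwa [Ne, Equiv.symm_apply_eq, hσ])
  · intro h x hxa hxl
    simpa using h (σ x) (fun e => hxa (σ.injective e))
      (fun e => hxl (σ.injective (e.trans hσ.symm)))

theorem pt_V_swap_mul_self {a ln : Fin n} (ha : a ≠ ln) :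
    pt ln (V n d (Equiv.swap a ln)) * pt ln (V n d (Equiv.swap a ln)) =
      (d : ℂ) • pt ln (V n d (Equiv.swap a ln)) := by
  ext f h
  have key : ∀ g : Fin n → Fin d,
      pt ln (V n d (Equiv.swap a ln)) f g * pt ln (V n d (Equiv.swap a ln)) g h =
        ∑ c : Fin d, if g = Function.update (Function.update f a c) ln c then
          pt ln (V n d (Equiv.swap a ln)) f h else 0 := by
    intro g
    have hc : ∀ c : Fin d, g = Function.update (Function.update f a c) ln c ↔
        c = g a ∧ g a = g ln ∧ ∀ x, x ≠ a → x ≠ ln → f x = g x := by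
      intro c
      rw [funext_iff]
      constructor
      · intro e
        have e1 := e a
        have e2 := e ln
        simp only [Function.update_self, Function.update_of_ne ha] at e1 e2
        refine ⟨e1.symm, e1.trans e2.symm, fun x hxa hxl => ?_⟩
        simpa [hxa, hxl, eq_comm] using e x
      · rintro ⟨e1, e2, e3⟩ x
        by_cases hxl : x = ln
        · subst hxl
          simp [e1, e2]
        · by_cases hxa : x = a
          · subst hxa
            simp [hxl, e1]
          · simp [hxl, hxa, e3 x hxa hxl]
    simp only [hc, ite_and, Finset.sum_ite_eq', Finset.mem_univ, if_true, pt_V_swap_apply ha]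
    by_cases e2 : g a = g ln
    · by_cases e3 : ∀ x, x ≠ a → x ≠ ln → f x = g x
      · have e4 : (∀ x, x ≠ a → x ≠ ln → g x = h x) ↔ ∀ x, x ≠ a → x ≠ ln → f x = h x :=
          forall_congr' fun x => forall_congr' fun hxa => forall_congr' fun hxl => by
            rw [e3 x hxa hxl]
        simp only [if_pos e2, if_pos e3, e4]
        split_ifs <;> simp
      · simp [e2, e3]
    · simp [e2]
  rw [Matrix.mul_apply, Finset.sum_congr rfl fun g _ => key g, Finset.sum_comm]
  simp

theorem pt_V_swap_mul_V_swap_mul {a c ln : Fin n} (ha : a ≠ ln) (hc : c ≠ ln) (hca : c ≠ a) :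
    pt ln (V n d (Equiv.swap a ln)) * V n d (Equiv.swap c a) *
        pt ln (V n d (Equiv.swap a ln)) = pt ln (V n d (Equiv.swap a ln)) := by
  ext f h
  have key : ∀ g : Fin n → Fin d,
      pt ln (V n d (Equiv.swap a ln)) f g *
          pt ln (V n d (Equiv.swap a ln)) (g ∘ Equiv.swap c a) h =
        if g = Function.update (Function.update f a (f c)) ln (f c) then
          pt ln (V n d (Equiv.swap a ln)) f h else 0 := by
    intro g
    rw [pt_V_swap_apply ha, pt_V_swap_apply ha, pt_V_swap_apply ha]
    simp only [← ite_and, ite_mul, one_mul, zero_mul]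
    congr 1
    simp only [Function.comp_apply, Equiv.swap_apply_right,
      Equiv.swap_apply_of_ne_of_ne hc.symm ha.symm, eq_iff_iff]
    constructor
    · rintro ⟨⟨h1, h2, h3⟩, h4, h5, h6⟩
      have hfc := h3 c hca hc
      refine ⟨?_, h1, h5, fun x hxa hxl => ?_⟩
      · funext x
        by_cases hxl : x = ln
        · subst hxl
          simp [hfc, h4]
        · by_cases hxa : x = a
          · subst hxa
            simp [hxl, hfc, h4, h2]
          · simp [hxl, hxa, h3 x hxa hxl]
      · have h7 := h6 x hxa hxl
        by_cases hxc : x = c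
        · subst hxc
          rw [Equiv.swap_apply_left] at h7
          rw [hfc, h4, ← h2, h7]
        · rw [Equiv.swap_apply_of_ne_of_ne hxc hxa] at h7
          rw [h3 x hxa hxl, h7]
    · rintro ⟨rfl, h1, h2, h3⟩
      refine ⟨⟨h1, by simp [ha], fun x hxa hxl => by simp [hxa, hxl]⟩, by simp [hc, hca], h2,
        fun x hxa hxl => ?_⟩
      by_cases hxc : x = c
      · subst hxc
        simp [ha, h3 x hxa hxl]
      · simp [Equiv.swap_apply_of_ne_of_ne hxc hxa, hxa, hxl, h3 x hxa hxl]
  rw [Matrix.mul_assoc, Matrix.mul_apply]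
  simp only [V_mul_apply]
  rw [Finset.sum_congr rfl fun g _ => key g]
  simp

end PermutationOperators

section SchurOrthogonality

variable {G : Type*} [Group G] [Fintype G] {ι : Type*} [Fintype ι] [DecidableEq ι] [Nonempty ι]

theorem sum_apply_mul_apply_inv_of_irreducible (ψ : G →* Matrix ι ι ℂ)
    (hirr : ∀ M : Matrix ι ι ℂ, (∀ σ, M * ψ σ = ψ σ * M) → ∃ c : ℂ, M = c • (1 : Matrix ι ι ℂ))
    (m r j i : ι) :
    ∑ σ, ψ σ m r * ψ σ⁻¹ j i =
      if m = i ∧ r = j then (Fintype.card G : ℂ) / Fintype.card ι else 0 := by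
  set M : Matrix ι ι ℂ := ∑ σ, ψ σ * Matrix.single r j 1 * ψ σ⁻¹ with hM
  have hcomm : ∀ σ, M * ψ σ = ψ σ * M := by
    intro σ
    rw [hM, Finset.sum_mul, Finset.mul_sum, ← Equiv.sum_comp (Equiv.mulLeft σ)]
    refine Finset.sum_congr rfl fun τ _ => ?_
    simp only [Equiv.coe_mulLeft, mul_inv_rev, map_mul, mul_assoc]
    rw [← map_mul ψ σ⁻¹ σ, inv_mul_cancel, map_one, mul_one]
  obtain ⟨c, hc⟩ := hirr M hcomm
  have htr : (Fintype.card G : ℂ) * (if r = j then 1 else 0) = c * Fintype.card ι := by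
    have h1 : M.trace = c * Fintype.card ι := by
      rw [hc, Matrix.trace_smul, Matrix.trace_one, smul_eq_mul]
    rw [← h1, hM, Matrix.trace_sum]
    have h2 : ∀ σ, (ψ σ * Matrix.single r j (1 : ℂ) * ψ σ⁻¹).trace = if r = j then 1 else 0 := by
      intro σ
      rw [Matrix.trace_mul_comm, ← mul_assoc, ← map_mul, inv_mul_cancel, map_one, one_mul]
      split_ifs with h
      · subst h
        exact Matrix.trace_single_eq_same r 1
      · exact Matrix.trace_single_eq_of_ne r j 1 h
    simp [h2]
  have hent : M m i = ∑ σ, ψ σ m r * ψ σ⁻¹ j i := by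
    rw [hM, Matrix.sum_apply]
    refine Finset.sum_congr rfl fun σ _ => ?_
    simp [Matrix.mul_apply, Matrix.single_apply, ite_and, Finset.sum_ite_eq]
  have hι : (Fintype.card ι : ℂ) ≠ 0 := Nat.cast_ne_zero.2 Fintype.card_ne_zero
  rw [← hent, hc, Matrix.smul_apply, Matrix.one_apply, smul_eq_mul]
  by_cases hmi : m = i <;> by_cases hrj : r = j <;> simp_all

/-- Matrix units of an irreducible matrix representation, evaluated in an algebra. -/
theorem sum_smul_mul_mul_sum_smul_of_irreducible {A : Type*} [Ring A] [Algebra ℂ A]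
    (ψ : G →* Matrix ι ι ℂ)
    (hirr : ∀ M : Matrix ι ι ℂ, (∀ σ, M * ψ σ = ψ σ * M) → ∃ c : ℂ, M = c • (1 : Matrix ι ι ℂ))
    (U : G →* A) (ρ : G) (i j k l : ι) :
    (∑ σ, ψ σ⁻¹ j i • U σ) * U ρ * (∑ σ, ψ σ⁻¹ l k • U σ) =
      ((Fintype.card G : ℂ) / Fintype.card ι * ψ ρ j k) • ∑ σ, ψ σ⁻¹ l i • U σ := by
  have h1 : ∀ σ, (ψ σ⁻¹ j i • U σ) * U ρ * (∑ τ, ψ τ⁻¹ l k • U τ) =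
      ∑ π, (ψ σ⁻¹ j i * ψ (π⁻¹ * σ * ρ) l k) • U π := by
    intro σ
    rw [← Equiv.sum_comp (Equiv.mulLeft (σ * ρ))
      (fun π => (ψ σ⁻¹ j i * ψ (π⁻¹ * σ * ρ) l k) • U π), Finset.mul_sum]
    refine Finset.sum_congr rfl fun τ _ => ?_
    have hτ : (σ * ρ * τ)⁻¹ * σ * ρ = τ⁻¹ := by group
    simp only [Equiv.coe_mulLeft, smul_mul_assoc, mul_smul_comm, smul_smul, ← map_mul, hτ]
    rw [mul_comm]
  have h2 : ∀ π, ∑ σ, ψ σ⁻¹ j i * ψ (π⁻¹ * σ * ρ) l k =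
      (Fintype.card G : ℂ) / Fintype.card ι * ψ ρ j k * ψ π⁻¹ l i := by
    intro π
    have h3 : ∀ σ, ψ σ⁻¹ j i * ψ (π⁻¹ * σ * ρ) l k =
        ∑ r, ∑ m, ψ π⁻¹ l m * ψ ρ r k * (ψ σ m r * ψ σ⁻¹ j i) := by
      intro σ
      simp only [map_mul, Matrix.mul_apply, Finset.mul_sum, Finset.sum_mul]
      refine Finset.sum_congr rfl fun r _ => Finset.sum_congr rfl fun m _ => ?_
      ring
    rw [Finset.sum_congr rfl fun σ _ => h3 σ, Finset.sum_comm]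
    have h4 : ∀ r, ∑ σ, ∑ m, ψ π⁻¹ l m * ψ ρ r k * (ψ σ m r * ψ σ⁻¹ j i) =
        ∑ m, ψ π⁻¹ l m * ψ ρ r k *
          if m = i ∧ r = j then (Fintype.card G : ℂ) / Fintype.card ι else 0 := by
      intro r
      rw [Finset.sum_comm]
      refine Finset.sum_congr rfl fun m _ => ?_
      rw [← Finset.mul_sum, sum_apply_mul_apply_inv_of_irreducible ψ hirr]
    simp only [h4, ite_and, mul_ite, mul_zero, Finset.sum_ite_eq', Finset.mem_univ, if_true]
    ring
  rw [Finset.sum_mul, Finset.sum_mul, Finset.sum_congr rfl fun σ _ => h1 σ, Finset.sum_comm,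
    Finset.smul_sum]
  refine Finset.sum_congr rfl fun π _ => ?_
  rw [← Finset.sum_smul, h2, smul_smul]

end SchurOrthogonality

section PairStabilizer

variable {n : ℕ}

/-- The permutations fixing two given points. -/
def pairStabilizer (x y : Fin n) : Subgroup (Equiv.Perm (Fin n)) where
  carrier := {σ | σ x = x ∧ σ y = y}
  one_mem' := ⟨rfl, rfl⟩
  mul_mem' := by
    rintro σ τ ⟨h1, h2⟩ ⟨h3, h4⟩
    exact ⟨by rw [Equiv.Perm.mul_apply, h3, h1], by rw [Equiv.Perm.mul_apply, h4, h2]⟩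
  inv_mem' := by
    rintro σ ⟨h1, h2⟩
    exact ⟨by rw [Equiv.Perm.inv_eq_iff_eq, h1], by rw [Equiv.Perm.inv_eq_iff_eq, h2]⟩

theorem mem_pairStabilizer {x y : Fin n} {σ : Equiv.Perm (Fin n)} :
    σ ∈ pairStabilizer x y ↔ σ x = x ∧ σ y = y := Iff.rfl

instance (x y : Fin n) : DecidablePred (· ∈ pairStabilizer x y) :=
  fun σ => inferInstanceAs (Decidable (σ x = x ∧ σ y = y))

theorem card_pairStabilizer {x y : Fin n} (hxy : x ≠ y) :
    Fintype.card (pairStabilizer x y) = (n - 2).factorial := by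
  let p : Fin n → Prop := fun z => z ∈ ({x, y} : Finset (Fin n))ᶜ
  have e : pairStabilizer x y ≃ {σ : Equiv.Perm (Fin n) // ∀ z, ¬ p z → σ z = z} :=
    Equiv.subtypeEquivRight fun σ => by
    simp [p, mem_pairStabilizer, ← or_iff_not_imp_left, or_imp, forall_and]
  rw [Fintype.card_congr (e.trans (Equiv.Perm.subtypeEquivSubtypePerm p).symm),
    Fintype.card_perm, Fintype.card_coe, Finset.card_compl, Finset.card_pair hxy, Fintype.card_fin]

theorem swap_mul_swap_mul_swap_mem_pairStabilizer {ln ln1 b p : Fin n} (h : ln1 ≠ ln)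
    (hb : b ≠ ln) (hp : p ≠ ln) :
    Equiv.swap b ln1 * Equiv.swap b p * Equiv.swap p ln1 ∈ pairStabilizer ln ln1 := by
  rw [mem_pairStabilizer]
  simp only [Equiv.Perm.mul_apply, Equiv.swap_apply_right, Equiv.swap_apply_left,
    Equiv.swap_apply_of_ne_of_ne hp.symm h.symm, Equiv.swap_apply_of_ne_of_ne hb.symm hp.symm,
    Equiv.swap_apply_of_ne_of_ne hb.symm h.symm, and_self]

end PairStabilizer

section Emat

variable {n d w : ℕ} {ln ln1 : Fin n} {φ : Equiv.Perm (Fin n) → Matrix (Fin w) (Fin w) ℂ}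

theorem Emat_eq_sum_pairStabilizer (i j : Fin w) :
    Emat n d w ln ln1 φ i j = ((w : ℂ) / (Nat.factorial (n - 2) : ℂ)) •
      ∑ σ : pairStabilizer ln ln1, φ (σ⁻¹ : pairStabilizer ln ln1) j i • V n d σ := by
  rw [Emat]
  congr 1
  exact Finset.sum_subtype _ (fun σ => by simp [mem_pairStabilizer])
    (fun σ => φ σ⁻¹ j i • V n d σ)

theorem Emat_mul_V_mul_Emat (hw : 1 ≤ w) (hne : ln ≠ ln1) (hid : φ 1 = 1)
    (hmul : ∀ σ τ : Equiv.Perm (Fin n),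
      σ ln = ln → σ ln1 = ln1 → τ ln = ln → τ ln1 = ln1 → φ (σ * τ) = φ σ * φ τ)
    (hirred : ∀ M : Matrix (Fin w) (Fin w) ℂ,
      (∀ σ : Equiv.Perm (Fin n), σ ln = ln → σ ln1 = ln1 → M * φ σ = φ σ * M) →
      ∃ c : ℂ, M = c • (1 : Matrix (Fin w) (Fin w) ℂ))
    {ρ : Equiv.Perm (Fin n)} (hρ : ρ ∈ pairStabilizer ln ln1) (i j k l : Fin w) :
    Emat n d w ln ln1 φ i j * V n d ρ * Emat n d w ln ln1 φ k l =
      φ ρ j k • Emat n d w ln ln1 φ i l := by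
  have : Nonempty (Fin w) := ⟨⟨0, hw⟩⟩
  let ψ : pairStabilizer ln ln1 →* Matrix (Fin w) (Fin w) ℂ :=
    { toFun := fun σ => φ σ
      map_one' := hid
      map_mul' := fun σ τ => hmul σ τ σ.2.1 σ.2.2 τ.2.1 τ.2.2 }
  let U : pairStabilizer ln ln1 →* Matrix (Fin n → Fin d) (Fin n → Fin d) ℂ :=
    { toFun := fun σ => V n d σ
      map_one' := V_one
      map_mul' := fun σ τ => (V_mul_V _ _).symm }
  have key := sum_smul_mul_mul_sum_smul_of_irreducible ψ
    (fun M hM => hirred M fun σ h1 h2 => hM ⟨σ, h1, h2⟩) U ⟨ρ, hρ⟩ i j k l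
  simp only [ψ, U, MonoidHom.coe_mk, OneHom.coe_mk, card_pairStabilizer hne,
    Fintype.card_fin] at key
  simp only [Emat_eq_sum_pairStabilizer]
  rw [Matrix.smul_mul, Matrix.smul_mul, Matrix.mul_smul, key, smul_smul, smul_smul, smul_smul]
  congr 1
  have hw0 : (w : ℂ) ≠ 0 := Nat.cast_ne_zero.2 (by omega)
  have hf : ((n - 2).factorial : ℂ) ≠ 0 := Nat.cast_ne_zero.2 (Nat.factorial_ne_zero _)
  field_simp

theorem commute_pt_V_swap_V (hne : ln1 ≠ ln) {σ : Equiv.Perm (Fin n)}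
    (hσ : σ ∈ pairStabilizer ln ln1) :
    Commute (pt ln (V n d (Equiv.swap ln1 ln))) (V n d σ) := by
  have h := V_mul_pt_V_swap (d := d) hne hσ.1
  rw [hσ.2] at h
  exact h.symm

theorem commute_pt_V_swap_Emat (hne : ln1 ≠ ln) (i j : Fin w) :
    Commute (pt ln (V n d (Equiv.swap ln1 ln))) (Emat n d w ln ln1 φ i j) := by
  rw [Emat_eq_sum_pairStabilizer]
  exact (Commute.sum_right _ _ _ fun σ _ =>
    (commute_pt_V_swap_V hne σ.2).smul_right _).smul_right _

theorem umat_eq (hne : ln1 ≠ ln) {a : Fin n} (ha : a ≠ ln) (b : Fin n) (i j : Fin w) :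
    umat n d w ln ln1 φ a b i j =
      V n d (Equiv.swap a ln1) * pt ln (V n d (Equiv.swap ln1 ln)) *
        Emat n d w ln ln1 φ i j * V n d (Equiv.swap b ln1) := by
  have h := V_mul_pt_V_swap (d := d) hne (Equiv.swap_apply_of_ne_of_ne ha.symm hne.symm)
  rw [Equiv.swap_apply_right] at h
  rw [umat, h]

theorem pt_V_swap_mul_V_mul_pt_V_swap (hne : ln1 ≠ ln) {b p : Fin n} (hb : b ≠ ln)
    (hp : p ≠ ln) :
    pt ln (V n d (Equiv.swap ln1 ln)) * (V n d (Equiv.swap b ln1) * V n d (Equiv.swap p ln1)) *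
        pt ln (V n d (Equiv.swap ln1 ln)) =
      (d : ℂ) ^ (if b = p then 1 else 0 : ℕ) •
        (V n d (Equiv.swap b ln1 * Equiv.swap b p * Equiv.swap p ln1) *
          pt ln (V n d (Equiv.swap ln1 ln))) := by
  rw [V_mul_V]
  by_cases hbp : b = p
  · subst hbp
    simp [← Equiv.Perm.one_def, V_one, pt_V_swap_mul_self hne]
  rw [if_neg hbp, pow_zero, one_smul]
  by_cases hb1 : b = ln1
  · subst hb1
    simpa [← Equiv.Perm.one_def, Equiv.swap_comm b p, V_one] using
      pt_V_swap_mul_V_swap_mul hne hp (Ne.symm hbp)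
  by_cases hp1 : p = ln1
  · subst hp1
    simpa [← Equiv.Perm.one_def, V_one] using pt_V_swap_mul_V_swap_mul hne hb hbp
  have hρ := swap_mul_swap_mul_swap_mem_pairStabilizer hne hb hp
  have hτ : Equiv.swap b ln1 * Equiv.swap p ln1 =
      Equiv.swap b ln1 * Equiv.swap b p * Equiv.swap p ln1 * Equiv.swap b ln1 := by
    rw [mul_assoc (_ * _), Equiv.mul_swap_eq_swap_mul (Equiv.swap p ln1), Equiv.swap_apply_right,
      Equiv.swap_apply_of_ne_of_ne hbp hb1, mul_assoc, Equiv.swap_mul_self_mul]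
  rw [hτ, ← V_mul_V, ← mul_assoc, (commute_pt_V_swap_V hne hρ).eq, mul_assoc, mul_assoc,
    ← mul_assoc (pt ln _), pt_V_swap_mul_V_swap_mul hne hb hb1]

end Emat

open Matrix in
/-- Multiplication rule for the elements `u^{ab}_{ij}`:
`u^{ab}_{ij} · u^{pq}_{kl} = d^{δ_{bp}} · φ_{jk}((b n−1)(b p)(p n−1)) · u^{aq}_{il}`;
in particular `u^{aa}_{ii} · u^{aa}_{ii} = d · u^{aa}_{ii}`, i.e. the `u^{aa}_{ii}`
are essential projectors. -/
theorem umat_mul_umat (n d w : ℕ) (hn : 3 ≤ n) (hd : 1 ≤ d) (hw : 1 ≤ w)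
    (ln ln1 : Fin n) (hln : (ln : ℕ) = n - 1) (hln1 : (ln1 : ℕ) = n - 2)
    (φ : Equiv.Perm (Fin n) → Matrix (Fin w) (Fin w) ℂ)
    (hid : φ 1 = 1)
    (hmul : ∀ σ τ : Equiv.Perm (Fin n),
      σ ln = ln → σ ln1 = ln1 → τ ln = ln → τ ln1 = ln1 → φ (σ * τ) = φ σ * φ τ)
    (hunitary : ∀ σ : Equiv.Perm (Fin n), σ ln = ln → σ ln1 = ln1 → (φ σ)ᴴ * φ σ = 1)
    (hirred : ∀ M : Matrix (Fin w) (Fin w) ℂ,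
      (∀ σ : Equiv.Perm (Fin n), σ ln = ln → σ ln1 = ln1 → M * φ σ = φ σ * M) →
      ∃ c : ℂ, M = c • (1 : Matrix (Fin w) (Fin w) ℂ)) :
    (∀ a b p q : Fin n, a ≠ ln → b ≠ ln → p ≠ ln → q ≠ ln →
      ∀ i j k l : Fin w,
        umat n d w ln ln1 φ a b i j * umat n d w ln ln1 φ p q k l =
          (((d : ℂ) ^ (if b = p then 1 else 0 : ℕ)) *
            φ (Equiv.swap b ln1 * Equiv.swap b p * Equiv.swap p ln1) j k) •
              umat n d w ln ln1 φ a q i l) ∧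
    (∀ a : Fin n, a ≠ ln → ∀ i : Fin w,
      umat n d w ln ln1 φ a a i i * umat n d w ln ln1 φ a a i i =
        (d : ℂ) • umat n d w ln ln1 φ a a i i) := by
  have hne : ln1 ≠ ln := fun h => by
    have := congrArg Fin.val h
    omega
  have main : ∀ a b p q : Fin n, a ≠ ln → b ≠ ln → p ≠ ln → q ≠ ln →
      ∀ i j k l : Fin w,
        umat n d w ln ln1 φ a b i j * umat n d w ln ln1 φ p q k l =
          (((d : ℂ) ^ (if b = p then 1 else 0 : ℕ)) *
            φ (Equiv.swap b ln1 * Equiv.swap b p * Equiv.swap p ln1) j k) •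
              umat n d w ln ln1 φ a q i l := by
    intro a b p q ha hb hp _ i j k l
    have hQ := pt_V_swap_mul_V_mul_pt_V_swap (d := d) hne hb hp
    have hρ := swap_mul_swap_mul_swap_mem_pairStabilizer hne hb hp
    have hE := Emat_mul_V_mul_Emat (d := d) hw hne.symm hid hmul hirred hρ i j k l
    have hC : ∀ i j, pt ln (V n d (Equiv.swap ln1 ln)) * Emat n d w ln ln1 φ i j =
        Emat n d w ln ln1 φ i j * pt ln (V n d (Equiv.swap ln1 ln)) :=
      fun i j => (commute_pt_V_swap_Emat hne i j).eq
    rw [umat_eq hne ha, umat_eq hne hp, umat_eq hne ha]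
    set ρ := Equiv.swap b ln1 * Equiv.swap b p * Equiv.swap p ln1
    set Q := pt ln (V n d (Equiv.swap ln1 ln))
    calc _ = V n d (Equiv.swap a ln1) * (Q * Emat n d w ln ln1 φ i j) *
          (V n d (Equiv.swap b ln1) * V n d (Equiv.swap p ln1)) * Q *
          Emat n d w ln ln1 φ k l * V n d (Equiv.swap q ln1) := by simp only [mul_assoc]
      _ = V n d (Equiv.swap a ln1) * Emat n d w ln ln1 φ i j *
          (Q * (V n d (Equiv.swap b ln1) * V n d (Equiv.swap p ln1)) * Q) *
          Emat n d w ln ln1 φ k l * V n d (Equiv.swap q ln1) := by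
        rw [hC]
        simp only [mul_assoc]
      _ = (d : ℂ) ^ (if b = p then 1 else 0 : ℕ) • (V n d (Equiv.swap a ln1) *
          (Emat n d w ln ln1 φ i j * V n d ρ * (Q * Emat n d w ln ln1 φ k l)) *
          V n d (Equiv.swap q ln1)) := by
        rw [hQ]
        simp only [mul_assoc, smul_mul_assoc, mul_smul_comm]
      _ = _ := by
        rw [hC, ← mul_assoc (_ * _) _ Q, hE, mul_smul, smul_mul_assoc, ← hC]
        simp only [mul_assoc, smul_mul_assoc, mul_smul_comm]
  refine ⟨main, fun a ha i => ?_⟩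
  rw [main a a a a ha ha ha ha i i i i]
  simp [← Equiv.Perm.one_def, hid]
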